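/- Let A be an n×n real matrix with all diagonal entries nonzero, f a real n-vector, and u⁰ a real n-vector. Perform a backward sweep of successive subspace correction over the one-dimensional subspaces span{e_n}, …, span{e_1} in decreasing order of the index: starting from u⁰, for i = n, n-1, …, 1 replace the current iterate u by u + (A_{ii})^{-1} (f - A u)_i e_i. Then the final iterate u¹ satisfies, for every index i, Σ_{j < i} A_{ij} u⁰_j + Σ_{j ≥ i} A_{ij} u¹_j = f_i; that is, the backward successive sweep coincides with one backward Gauss–Seidel iteration (the second half-step of a symmetric successive over-relaxation sweep with relaxation parameter ω = 1). -/

import Mathlib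

/-- One successive subspace correction step on `span{e_i}`. -/
noncomputable def sscStep {n : ℕ} (A : Matrix (Fin n) (Fin n) ℝ) (f : Fin n → ℝ)
    (i : Fin n) (u : Fin n → ℝ) : Fin n → ℝ :=
  u + ((A i i)⁻¹ * (f - A.mulVec u) i) • (Pi.single i 1 : Fin n → ℝ)

/-- A correction step on `span{e_i}` changes only the `i`-th coordinate. -/
theorem sscStep_apply_of_ne {n : ℕ} (A : Matrix (Fin n) (Fin n) ℝ) (f u : Fin n → ℝ)
    {i j : Fin n} (h : j ≠ i) : sscStep A f i u j = u j := by
  simp [sscStep, h]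

/-- After a correction step on `span{e_i}` the `i`-th equation holds exactly. -/
theorem mulVec_sscStep_apply_self {n : ℕ} (A : Matrix (Fin n) (Fin n) ℝ) (f u : Fin n → ℝ)
    {i : Fin n} (h : A i i ≠ 0) : A.mulVec (sscStep A f i u) i = f i := by
  simp only [sscStep, Matrix.mulVec_add, Matrix.mulVec_smul, Matrix.mulVec_single_one,
    Pi.add_apply, Pi.smul_apply, Pi.sub_apply, Matrix.col_apply, smul_eq_mul]
  field_simp
  ring

/-- Successive corrections along `l` leave the coordinates outside `l` unchanged. -/
theorem foldl_sscStep_apply_of_notMem {n : ℕ} (A : Matrix (Fin n) (Fin n) ℝ)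
    (f : Fin n → ℝ) {j : Fin n} (l : List (Fin n)) (u : Fin n → ℝ) (h : j ∉ l) :
    l.foldl (fun u i => sscStep A f i u) u j = u j := by
  induction l generalizing u with
  | nil => rfl
  | cons i l ih =>
    rw [List.mem_cons, not_or] at h
    rw [List.foldl_cons, ih _ h.2, sscStep_apply_of_ne A f u h.1]

/-- A backward sweep of successive subspace correction over the one-dimensional
subspaces `span{e_n}, …, span{e_1}` coincides with one backward Gauss–Seidel
iteration. -/
theorem backward_subspace_correction_is_backward_gauss_seidel
    {n : ℕ} (A : Matrix (Fin n) (Fin n) ℝ) (f u0 : Fin n → ℝ)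
    (hA : ∀ i, A i i ≠ 0) :
    let u1 := (List.finRange n).reverse.foldl (fun u i => sscStep A f i u) u0
    ∀ i : Fin n,
      (∑ j ∈ Finset.Iio i, A i j * u0 j) + (∑ j ∈ Finset.Ici i, A i j * u1 j)
        = f i := by
  intro u1 i
  obtain ⟨l₁, l₂, hl⟩ := List.append_of_mem (List.mem_reverse.2 (List.mem_finRange i))
  have hs : (l₁ ++ i :: l₂).Pairwise (fun a b => b < a) := by
    rw [← hl, List.pairwise_reverse]
    exact List.pairwise_lt_finRange n
  obtain ⟨-, hs₂, hs₁⟩ := List.pairwise_append.1 hs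
  set v := sscStep A f i (l₁.foldl (fun u i => sscStep A f i u) u0) with hv
  have hu1 : u1 = l₂.foldl (fun u i => sscStep A f i u) v := by
    simp only [u1, hl, List.foldl_append, List.foldl_cons, hv]
  have hlt : ∀ j ∈ Finset.Iio i, A i j * u0 j = A i j * v j := by
    intro j hj
    have hj := Finset.mem_Iio.1 hj
    rw [hv, sscStep_apply_of_ne A f _ hj.ne, foldl_sscStep_apply_of_notMem]
    exact fun hm => (hs₁ j hm i List.mem_cons_self).not_gt hj
  have hge : ∀ j ∈ Finset.Ici i, A i j * u1 j = A i j * v j := by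
    intro j hj
    rw [hu1, foldl_sscStep_apply_of_notMem]
    exact fun hm => ((List.pairwise_cons.1 hs₂).1 j hm).not_ge (Finset.mem_Ici.1 hj)
  have hdisj : Disjoint (Finset.Iio i) (Finset.Ici i) :=
    Finset.disjoint_left.2 fun j h₁ h₂ =>
      (Finset.mem_Iio.1 h₁).not_ge (Finset.mem_Ici.1 h₂)
  have hunion : Finset.Iio i ∪ Finset.Ici i = Finset.univ := by
    ext j
    simp [lt_or_ge j i]
  rw [Finset.sum_congr rfl hlt, Finset.sum_congr rfl hge, ← Finset.sum_union hdisj, hunion]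
  exact mulVec_sscStep_apply_self A f _ (hA i)
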